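/- There exist positive constants C₁, C₁', C₂ such that for every integer k ≥ 1: (a) C₁ √k ≤ Ω_k''(0) ≤ C₁' √k, where Ω_k'' denotes the second derivative of Ω_k; and (b) |Ω_k'''(s)| ≤ C₂ k for all s ∈ [0, √3/2], where Ω_k''' denotes the third derivative of Ω_k. -/

import Mathlib

noncomputable section

open MeasureTheory ProbabilityTheory Real Filter Finset

/-- Physicists' Hermite polynomials: `H 0 = 1`, `H 1 x = 2 * x`,
`H (n+2) x = 2 * x * H (n+1) x - 2 * (n+1) * H n x`. -/
def physHermite : ℕ → ℝ → ℝ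
  | 0, _ => 1
  | 1, x => 2 * x
  | (n + 2), x => 2 * x * physHermite (n + 1) x - 2 * (n + 1) * physHermite n x

/-- The `L²(ℝ)`-normalized Hermite functions. -/
def hermiteFun (n : ℕ) (x : ℝ) : ℝ :=
  physHermite n x * Real.exp (-x ^ 2 / 2) /
    Real.sqrt (n.factorial * 2 ^ n * Real.sqrt Real.pi)

/-- `Ω_k(s) = h_k(1)² - h_k(√(1-s)) h_k(√(1+s))`. -/
def OmegaFun (k : ℕ) (s : ℝ) : ℝ :=
  hermiteFun k 1 ^ 2 - hermiteFun k (Real.sqrt (1 - s)) * hermiteFun k (Real.sqrt (1 + s))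

theorem hasDerivAt_physHermite (n : ℕ) (x : ℝ) :
    HasDerivAt (physHermite n) (2 * x * physHermite n x - physHermite (n + 1) x) x := by
  induction n using Nat.twoStepInduction with
  | zero =>
    have h0 : physHermite 0 = fun _ => 1 := by ext y; simp [physHermite]
    rw [h0]
    simpa [physHermite] using hasDerivAt_const x (1 : ℝ)
  | one =>
    have h1 : physHermite 1 = fun y => 2 * y := by ext y; simp [physHermite]
    rw [h1]
    refine ((hasDerivAt_id x).const_mul 2).congr_deriv ?_
    simp [physHermite]
  | more n ih₀ ih₁ =>
    have h2 : physHermite (n + 2) = fun y =>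
        2 * y * physHermite (n + 1) y - 2 * (n + 1) * physHermite n y := by
      ext y; simp [physHermite]
    rw [h2]
    refine ((((hasDerivAt_id x).const_mul 2).mul ih₁).sub
      (ih₀.const_mul (2 * ((n : ℝ) + 1)))).congr_deriv ?_
    simp only [physHermite, id]
    push_cast
    ring

/-- The normalization constant of `hermiteFun n`. -/
def hermiteNorm (n : ℕ) : ℝ := Real.sqrt (n.factorial * 2 ^ n * Real.sqrt Real.pi)

theorem hermiteNorm_sq (n : ℕ) :
    hermiteNorm n ^ 2 = n.factorial * 2 ^ n * Real.sqrt Real.pi :=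
  Real.sq_sqrt (by positivity)

/-- The derivative of `hermiteFun n`. -/
def hermiteFunDeriv (n : ℕ) (x : ℝ) : ℝ :=
  (x * physHermite n x - physHermite (n + 1) x) * Real.exp (-x ^ 2 / 2) / hermiteNorm n

theorem hasDerivAt_exp_neg_sq_half (x : ℝ) :
    HasDerivAt (fun y : ℝ => Real.exp (-y ^ 2 / 2)) (-x * Real.exp (-x ^ 2 / 2)) x := by
  refine (((hasDerivAt_pow 2 x).neg.div_const 2).exp).congr_deriv ?_
  push_cast
  simp only [Pi.neg_apply]
  ring

theorem hasDerivAt_hermiteFun (n : ℕ) (x : ℝ) :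
    HasDerivAt (hermiteFun n) (hermiteFunDeriv n x) x := by
  refine (((hasDerivAt_physHermite n x).mul (hasDerivAt_exp_neg_sq_half x)).div_const
    (hermiteNorm n)).congr_deriv ?_
  unfold hermiteFunDeriv
  ring

theorem hasDerivAt_hermiteFunDeriv (n : ℕ) (x : ℝ) :
    HasDerivAt (hermiteFunDeriv n) ((x ^ 2 - (2 * n + 1)) * hermiteFun n x) x := by
  refine (((((hasDerivAt_id x).mul (hasDerivAt_physHermite n x)).sub
    (hasDerivAt_physHermite (n + 1) x)).mul (hasDerivAt_exp_neg_sq_half x)).div_const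
    (hermiteNorm n)).congr_deriv ?_
  have hN : Real.sqrt (n.factorial * 2 ^ n * Real.sqrt Real.pi) = hermiteNorm n := rfl
  simp only [hermiteFun, hN, physHermite, Pi.sub_apply, Pi.mul_apply, id]
  ring

/-- The energy of the oscillator equation `h'' = (x² - (2n+1)) h` at `x`. -/
def hermiteEnergy (n : ℕ) (x : ℝ) : ℝ :=
  hermiteFunDeriv n x ^ 2 + (2 * n + 1 - x ^ 2) * hermiteFun n x ^ 2

theorem hasDerivAt_hermiteEnergy (n : ℕ) (x : ℝ) :
    HasDerivAt (hermiteEnergy n) (-2 * x * hermiteFun n x ^ 2) x := by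
  refine (((hasDerivAt_hermiteFunDeriv n x).pow 2).add
    (((hasDerivAt_const x (2 * (n : ℝ) + 1)).sub (hasDerivAt_pow 2 x)).mul
      ((hasDerivAt_hermiteFun n x).pow 2))).congr_deriv ?_
  simp only [Pi.sub_apply, Pi.pow_apply]
  push_cast
  ring

theorem hermiteEnergy_le_zero (n : ℕ) {x : ℝ} (hx : 0 ≤ x) :
    hermiteEnergy n x ≤ hermiteEnergy n 0 := by
  have hanti : AntitoneOn (hermiteEnergy n) (Set.Ici 0) := by
    refine antitoneOn_of_deriv_nonpos (convex_Ici 0)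
      (fun y _ => (hasDerivAt_hermiteEnergy n y).continuousAt.continuousWithinAt)
      (fun y _ => (hasDerivAt_hermiteEnergy n y).differentiableAt.differentiableWithinAt)
      fun y hy => ?_
    rw [interior_Ici] at hy
    rw [(hasDerivAt_hermiteEnergy n y).deriv]
    nlinarith [mul_nonneg (le_of_lt hy) (sq_nonneg (hermiteFun n y))]
  exact hanti Set.self_mem_Ici hx hx

theorem hermiteEnergy_zero_le_two_mul (n : ℕ) (hn : 1 ≤ n) :
    hermiteEnergy n 0 ≤ 2 * hermiteEnergy n 1 := by
  have hd (y : ℝ) : HasDerivAt (fun y => (1 + y ^ 2) * hermiteEnergy n y)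
      (2 * y * (hermiteFunDeriv n y ^ 2 + (2 * n - 2 * y ^ 2) * hermiteFun n y ^ 2)) y := by
    refine ((((hasDerivAt_const y (1 : ℝ)).add (hasDerivAt_pow 2 y))).mul
      (hasDerivAt_hermiteEnergy n y)).congr_deriv ?_
    simp only [Pi.add_apply, hermiteEnergy]
    push_cast
    ring
  have hmono : MonotoneOn (fun y => (1 + y ^ 2) * hermiteEnergy n y) (Set.Icc 0 1) := by
    refine monotoneOn_of_deriv_nonneg (convex_Icc 0 1)
      (fun y _ => (hd y).continuousAt.continuousWithinAt)
      (fun y _ => (hd y).differentiableAt.differentiableWithinAt) fun y hy => ?_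
    rw [interior_Icc] at hy
    rw [(hd y).deriv]
    have hn' : (1 : ℝ) ≤ n := by exact_mod_cast hn
    have : 0 ≤ 2 * (n : ℝ) - 2 * y ^ 2 := by nlinarith [hy.1, hy.2]
    have := hy.1
    positivity
  have h := hmono (Set.left_mem_Icc.2 zero_le_one) (Set.right_mem_Icc.2 zero_le_one) zero_le_one
  norm_num at h
  exact h

/-- `√π` times the energy of `hermiteFun n` at the origin. -/
def originEnergy (n : ℕ) : ℝ :=
  (physHermite (n + 1) 0 ^ 2 + (2 * n + 1) * physHermite n 0 ^ 2) / (n.factorial * 2 ^ n)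

theorem hermiteEnergy_zero (n : ℕ) :
    hermiteEnergy n 0 = originEnergy n / Real.sqrt Real.pi := by
  have hN : Real.sqrt (n.factorial * 2 ^ n * Real.sqrt Real.pi) = hermiteNorm n := rfl
  simp only [hermiteEnergy, hermiteFunDeriv, hermiteFun, hN, originEnergy, div_pow,
    hermiteNorm_sq]
  norm_num
  field_simp

theorem originEnergy_add_two (n : ℕ) :
    originEnergy (n + 2) =
      (n + 2) / (n + 1) * (physHermite (n + 1) 0 ^ 2 / (n.factorial * 2 ^ n)) +
      (2 * n + 5) * (n + 1) / ((n + 2) * (2 * n + 1)) *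
        ((2 * n + 1) * physHermite n 0 ^ 2 / (n.factorial * 2 ^ n)) := by
  simp only [originEnergy, physHermite, Nat.factorial_succ]
  push_cast
  field_simp
  ring

theorem originEnergy_le (n : ℕ) (hn : 1 ≤ n) : originEnergy n ≤ 2 * Real.sqrt n := by
  induction n using Nat.twoStepInduction with
  | zero => omega
  | one => norm_num [originEnergy, physHermite]
  | more n ih _ =>
    rcases Nat.eq_zero_or_pos n with rfl | hpos
    · have : (5 / 4 : ℝ) ≤ Real.sqrt 2 := Real.le_sqrt_of_sq_le (by norm_num)
      norm_num [originEnergy, physHermite]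
      linarith
    · have hn' : (0 : ℝ) < n := by exact_mod_cast hpos
      have key (r : ℝ) (hr : r ^ 2 * n ≤ n + 2) : r * Real.sqrt n ≤ Real.sqrt (n + 2) := by
        refine Real.le_sqrt_of_sq_le ?_
        rwa [mul_pow, Real.sq_sqrt hn'.le]
      have h1 := key ((n + 2) / (n + 1)) (by
        rw [div_pow, div_mul_eq_mul_div, div_le_iff₀ (by positivity)]
        nlinarith)
      have h2 := key ((2 * n + 5) * (n + 1) / ((n + 2) * (2 * n + 1))) (by
        rw [div_pow, div_mul_eq_mul_div, div_le_iff₀ (by positivity), ← sub_nonneg]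
        have : (0 : ℝ) ≤ 4 * n ^ 3 + 16 * n ^ 2 + 19 * n + 8 := by positivity
        ring_nf
        nlinarith)
      have hS : 0 < Real.sqrt n := Real.sqrt_pos.2 hn'
      have hle := ih hpos
      rw [originEnergy_add_two]
      rw [originEnergy, add_div] at hle
      set p := physHermite (n + 1) 0 ^ 2 / ((n.factorial : ℝ) * 2 ^ n)
      set q := (2 * (n : ℝ) + 1) * physHermite n 0 ^ 2 / ((n.factorial : ℝ) * 2 ^ n)
      have hp : 0 ≤ p := by positivity
      have hq : 0 ≤ q := by positivity
      rw [← le_div_iff₀ hS] at h1 h2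
      push_cast
      calc _ ≤ Real.sqrt (n + 2) / Real.sqrt n * p + Real.sqrt (n + 2) / Real.sqrt n * q := by
            gcongr
        _ = Real.sqrt (n + 2) / Real.sqrt n * (p + q) := by ring
        _ ≤ Real.sqrt (n + 2) / Real.sqrt n * (2 * Real.sqrt n) := by gcongr
        _ = 2 * Real.sqrt (n + 2) := by field_simp

theorem sqrt_succ_le_originEnergy (n : ℕ) : Real.sqrt (n + 1) ≤ originEnergy n := by
  induction n using Nat.twoStepInduction with
  | zero => norm_num [originEnergy, physHermite]
  | one => norm_num [originEnergy, physHermite, Real.sqrt_le_iff]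
  | more n ih _ =>
    have key (r : ℝ) (h0 : 0 ≤ r) (hr : (n : ℝ) + 3 ≤ r ^ 2 * (n + 1)) :
        Real.sqrt (n + 3) ≤ r * Real.sqrt (n + 1) := by
      refine Real.sqrt_le_iff.2 ⟨by positivity, ?_⟩
      rwa [mul_pow, Real.sq_sqrt (by positivity)]
    have h1 := key ((n + 2) / (n + 1)) (by positivity) (by
      rw [div_pow, div_mul_eq_mul_div, le_div_iff₀ (by positivity)]
      nlinarith)
    have h2 := key ((2 * n + 5) * (n + 1) / ((n + 2) * (2 * n + 1))) (by positivity) (by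
      rw [div_pow, div_mul_eq_mul_div, le_div_iff₀ (by positivity), ← sub_nonneg]
      have : (0 : ℝ) ≤ 4 * (n : ℝ) ^ 3 + 20 * n ^ 2 + 31 * n + 13 := by positivity
      ring_nf
      nlinarith)
    have hS : 0 < Real.sqrt ((n : ℝ) + 1) := Real.sqrt_pos.2 (by positivity)
    rw [originEnergy_add_two]
    rw [originEnergy, add_div] at ih
    set p := physHermite (n + 1) 0 ^ 2 / ((n.factorial : ℝ) * 2 ^ n)
    set q := (2 * (n : ℝ) + 1) * physHermite n 0 ^ 2 / ((n.factorial : ℝ) * 2 ^ n)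
    have hp : 0 ≤ p := by positivity
    have hq : 0 ≤ q := by positivity
    rw [← div_le_iff₀ hS] at h1 h2
    calc Real.sqrt (((n + 2 : ℕ) : ℝ) + 1) = Real.sqrt (n + 3) := by push_cast; ring_nf
      _ = Real.sqrt (n + 3) / Real.sqrt (n + 1) * Real.sqrt (n + 1) := by field_simp
      _ ≤ Real.sqrt (n + 3) / Real.sqrt (n + 1) * (p + q) := by gcongr
      _ = Real.sqrt (n + 3) / Real.sqrt (n + 1) * p +
          Real.sqrt (n + 3) / Real.sqrt (n + 1) * q := by ring
      _ ≤ _ := by gcongr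

theorem hermiteEnergy_zero_le (n : ℕ) (hn : 1 ≤ n) :
    hermiteEnergy n 0 ≤ 2 * Real.sqrt n := by
  have hpi : 1 ≤ Real.sqrt Real.pi := Real.one_le_sqrt.2 (by linarith [Real.pi_gt_three])
  rw [hermiteEnergy_zero]
  have h := originEnergy_le n hn
  have h0 : 0 ≤ originEnergy n := by unfold originEnergy; positivity
  exact (div_le_self h0 hpi).trans h

theorem sqrt_div_two_le_hermiteEnergy_zero (n : ℕ) :
    Real.sqrt n / 2 ≤ hermiteEnergy n 0 := by
  have hpi : Real.sqrt Real.pi ≤ 2 :=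
    Real.sqrt_le_iff.2 ⟨by norm_num, by linarith [Real.pi_lt_four]⟩
  have hpi0 : 0 < Real.sqrt Real.pi := Real.sqrt_pos.2 Real.pi_pos
  rw [hermiteEnergy_zero]
  have h := sqrt_succ_le_originEnergy n
  have h' : Real.sqrt n ≤ Real.sqrt (n + 1) := Real.sqrt_le_sqrt (by linarith)
  have : 0 ≤ Real.sqrt n := Real.sqrt_nonneg _
  exact div_le_div₀ (by linarith) (by linarith) hpi0 hpi

/-- The derivative of order `j ≤ 3` of `u ↦ hermiteFun k (√u)` on `(0, ∞)`, expressed through the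
equation `4 u f'' + 2 f' = (u - (2k+1)) f`. -/
def sqrtHermite (k : ℕ) : ℕ → ℝ → ℝ
  | 0, u => hermiteFun k (Real.sqrt u)
  | 1, u => hermiteFunDeriv k (Real.sqrt u) / (2 * Real.sqrt u)
  | 2, u => ((u - (2 * k + 1)) * sqrtHermite k 0 u - 2 * sqrtHermite k 1 u) / (4 * u)
  | 3, u => (sqrtHermite k 0 u + (u - (2 * k + 1)) * sqrtHermite k 1 u
      - 6 * sqrtHermite k 2 u) / (4 * u)
  | _, _ => 0

theorem hasDerivAt_sqrtHermite_zero (k : ℕ) {u : ℝ} (hu : 0 < u) :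
    HasDerivAt (sqrtHermite k 0) (sqrtHermite k 1 u) u := by
  have h : sqrtHermite k 0 = fun u => hermiteFun k (Real.sqrt u) := by ext; simp [sqrtHermite]
  rw [h]
  refine ((hasDerivAt_hermiteFun k (Real.sqrt u)).comp u
    (Real.hasDerivAt_sqrt hu.ne')).congr_deriv ?_
  simp only [sqrtHermite]
  ring

theorem hasDerivAt_sqrtHermite_one (k : ℕ) {u : ℝ} (hu : 0 < u) :
    HasDerivAt (sqrtHermite k 1) (sqrtHermite k 2 u) u := by
  have h : sqrtHermite k 1 = fun u => hermiteFunDeriv k (Real.sqrt u) / (2 * Real.sqrt u) := by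
    ext; simp [sqrtHermite]
  have hs : 0 < Real.sqrt u := Real.sqrt_pos.2 hu
  rw [h]
  refine (((hasDerivAt_hermiteFunDeriv k (Real.sqrt u)).comp u
    (Real.hasDerivAt_sqrt hu.ne')).div ((Real.hasDerivAt_sqrt hu.ne').const_mul 2)
      (by positivity)).congr_deriv ?_
  have hsq : u = Real.sqrt u ^ 2 := (Real.sq_sqrt hu.le).symm
  simp only [sqrtHermite, Function.comp]
  generalize Real.sqrt u = x at *
  subst hsq
  field_simp
  ring

theorem hasDerivAt_sqrtHermite_two (k : ℕ) {u : ℝ} (hu : 0 < u) :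
    HasDerivAt (sqrtHermite k 2) (sqrtHermite k 3 u) u := by
  have h : sqrtHermite k 2 = fun u =>
      ((u - (2 * k + 1)) * sqrtHermite k 0 u - 2 * sqrtHermite k 1 u) / (4 * u) := by
    ext; simp [sqrtHermite]
  have h3 : sqrtHermite k 3 u = (sqrtHermite k 0 u + (u - (2 * k + 1)) * sqrtHermite k 1 u
      - 6 * sqrtHermite k 2 u) / (4 * u) := by simp only [sqrtHermite]
  have h2 : (u - (2 * k + 1)) * sqrtHermite k 0 u - 2 * sqrtHermite k 1 u =
      4 * u * sqrtHermite k 2 u := by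
    rw [congrFun h u]; field_simp
  rw [h3]
  nth_rewrite 1 [h]
  refine ((((((hasDerivAt_id u).sub_const (2 * (k : ℝ) + 1)).mul
    (hasDerivAt_sqrtHermite_zero k hu)).sub
    ((hasDerivAt_sqrtHermite_one k hu).const_mul 2)).div ((hasDerivAt_id u).const_mul 4)
      (by simp only [id]; positivity))).congr_deriv ?_
  simp only [Pi.sub_apply, Pi.mul_apply, id, h2]
  field_simp
  ring

theorem hasDerivAt_mul_reflect {f f' g g' : ℝ → ℝ} {s : ℝ}
    (hf : HasDerivAt f (f' (1 - s)) (1 - s)) (hg : HasDerivAt g (g' (1 + s)) (1 + s)) :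
    HasDerivAt (fun t => f (1 - t) * g (1 + t))
      (-(f' (1 - s) * g (1 + s)) + f (1 - s) * g' (1 + s)) s := by
  have h1 := hf.comp_const_sub 1 s
  have h2 := hg.comp_const_add 1 s
  refine (h1.mul h2).congr_deriv ?_
  ring

theorem iteratedDeriv_OmegaFun (k : ℕ) {s : ℝ} (hs : s ∈ Set.Ioo (-1 : ℝ) 1) :
    iteratedDeriv 2 (OmegaFun k) s =
      2 * (sqrtHermite k 1 (1 - s) * sqrtHermite k 1 (1 + s))
      - sqrtHermite k 2 (1 - s) * sqrtHermite k 0 (1 + s)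
      - sqrtHermite k 0 (1 - s) * sqrtHermite k 2 (1 + s) ∧
    iteratedDeriv 3 (OmegaFun k) s =
      sqrtHermite k 3 (1 - s) * sqrtHermite k 0 (1 + s)
      - 3 * (sqrtHermite k 2 (1 - s) * sqrtHermite k 1 (1 + s))
      + 3 * (sqrtHermite k 1 (1 - s) * sqrtHermite k 2 (1 + s))
      - sqrtHermite k 0 (1 - s) * sqrtHermite k 3 (1 + s) := by
  have hO : OmegaFun k = fun s => hermiteFun k 1 ^ 2
      - sqrtHermite k 0 (1 - s) * sqrtHermite k 0 (1 + s) := by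
    ext; simp [OmegaFun, sqrtHermite]
  have hopen : IsOpen (Set.Ioo (-1 : ℝ) 1) := isOpen_Ioo
  have hm {t : ℝ} (ht : t ∈ Set.Ioo (-1 : ℝ) 1) : 0 < 1 - t := by linarith [ht.2]
  have hp {t : ℝ} (ht : t ∈ Set.Ioo (-1 : ℝ) 1) : 0 < 1 + t := by linarith [ht.1]
  have d1 : Set.EqOn (iteratedDeriv 1 (OmegaFun k)) (fun s =>
      sqrtHermite k 1 (1 - s) * sqrtHermite k 0 (1 + s)
      - sqrtHermite k 0 (1 - s) * sqrtHermite k 1 (1 + s)) (Set.Ioo (-1) 1) := by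
    intro t ht
    rw [iteratedDeriv_one, hO]
    refine (((hasDerivAt_const t _).sub (hasDerivAt_mul_reflect
      (hasDerivAt_sqrtHermite_zero k (hm ht))
      (hasDerivAt_sqrtHermite_zero k (hp ht)))).congr_deriv ?_).deriv
    ring
  have d2 : Set.EqOn (iteratedDeriv 2 (OmegaFun k)) (fun s =>
      2 * (sqrtHermite k 1 (1 - s) * sqrtHermite k 1 (1 + s))
      - sqrtHermite k 2 (1 - s) * sqrtHermite k 0 (1 + s)
      - sqrtHermite k 0 (1 - s) * sqrtHermite k 2 (1 + s)) (Set.Ioo (-1) 1) := by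
    intro t ht
    rw [iteratedDeriv_succ, (d1.eventuallyEq_of_mem (hopen.mem_nhds ht)).deriv_eq]
    refine (((hasDerivAt_mul_reflect (hasDerivAt_sqrtHermite_one k (hm ht))
      (hasDerivAt_sqrtHermite_zero k (hp ht))).sub (hasDerivAt_mul_reflect
      (hasDerivAt_sqrtHermite_zero k (hm ht))
      (hasDerivAt_sqrtHermite_one k (hp ht)))).congr_deriv ?_).deriv
    ring
  refine ⟨d2 hs, ?_⟩
  rw [iteratedDeriv_succ, (d2.eventuallyEq_of_mem (hopen.mem_nhds hs)).deriv_eq]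
  refine (((((hasDerivAt_mul_reflect (hasDerivAt_sqrtHermite_one k (hm hs))
    (hasDerivAt_sqrtHermite_one k (hp hs))).const_mul 2).sub (hasDerivAt_mul_reflect
    (hasDerivAt_sqrtHermite_two k (hm hs)) (hasDerivAt_sqrtHermite_zero k (hp hs)))).sub
    (hasDerivAt_mul_reflect (hasDerivAt_sqrtHermite_zero k (hm hs))
    (hasDerivAt_sqrtHermite_two k (hp hs)))).congr_deriv ?_).deriv
  ring

theorem iteratedDeriv_two_OmegaFun_zero (k : ℕ) :
    iteratedDeriv 2 (OmegaFun k) 0 =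
      (hermiteEnergy k 1 + hermiteFun k 1 * hermiteFunDeriv k 1) / 2 := by
  rw [(iteratedDeriv_OmegaFun k (s := 0) (by norm_num)).1]
  simp only [sqrtHermite, hermiteEnergy, sub_zero, add_zero, Real.sqrt_one]
  ring

theorem abs_sqrtHermite_le (k : ℕ) (hk : 1 ≤ k) {u : ℝ} (hu₀ : 1 / 8 ≤ u) (hu₁ : u ≤ 15 / 8)
    {K a : ℝ} (hK : K = Real.sqrt k) (ha : a = Real.sqrt (2 * K)) :
    |sqrtHermite k 0 u| ≤ a / K ∧ |sqrtHermite k 1 u| ≤ 2 * a ∧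
      |sqrtHermite k 2 u| ≤ 14 * a * K ∧ |sqrtHermite k 3 u| ≤ 182 * a * K ^ 2 := by
  have hk' : (1 : ℝ) ≤ k := by exact_mod_cast hk
  have hK1 : 1 ≤ K := hK ▸ Real.one_le_sqrt.2 hk'
  have hKk : (k : ℝ) = K ^ 2 := by rw [hK, Real.sq_sqrt (by positivity)]
  have ha0 : 0 ≤ a := ha ▸ Real.sqrt_nonneg _
  have ha2 : a ^ 2 = 2 * K := by rw [ha, Real.sq_sqrt (by positivity)]
  have hx : 1 / 3 ≤ Real.sqrt u := Real.le_sqrt_of_sq_le (by linarith)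
  have hxu : Real.sqrt u ^ 2 = u := Real.sq_sqrt (by linarith)
  have hE : hermiteEnergy k (Real.sqrt u) ≤ a ^ 2 := by
    rw [ha2, hK]
    exact (hermiteEnergy_le_zero k (Real.sqrt_nonneg u)).trans (hermiteEnergy_zero_le k hk)
  rw [hermiteEnergy, hxu, hKk] at hE
  have hsq := sq_nonneg (hermiteFun k (Real.sqrt u))
  have hcoef : K ^ 2 ≤ 2 * K ^ 2 + 1 - u := by nlinarith
  have h0 : |sqrtHermite k 0 u| ≤ a / K := by
    rw [le_div_iff₀ (by linarith)]
    refine abs_le_of_sq_le_sq' ?_ ha0 |>.2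
    simp only [sqrtHermite]
    rw [mul_pow, sq_abs]
    nlinarith [mul_le_mul_of_nonneg_right hcoef hsq, sq_nonneg (hermiteFunDeriv k (Real.sqrt u))]
  have hh' : |hermiteFunDeriv k (Real.sqrt u)| ≤ a := by
    refine abs_le_of_sq_le_sq ?_ ha0
    nlinarith [mul_le_mul_of_nonneg_right hcoef hsq, mul_nonneg (sq_nonneg K) hsq]
  have h1 : |sqrtHermite k 1 u| ≤ 2 * a := by
    simp only [sqrtHermite]
    rw [abs_div, abs_of_pos (show 0 < 2 * Real.sqrt u by linarith), div_le_iff₀ (by linarith)]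
    nlinarith
  have hM : |u - (2 * k + 1)| ≤ 3 * K ^ 2 := by
    rw [hKk, abs_le]; constructor <;> nlinarith
  have hdiv (y : ℝ) : |y / (4 * u)| ≤ 2 * |y| := by
    rw [abs_div, abs_of_pos (show 0 < 4 * u by linarith), div_le_iff₀ (by linarith)]
    nlinarith [abs_nonneg y]
  have haK : a ≤ a * K := le_mul_of_one_le_right ha0 hK1
  have haK2 : a * K ≤ a * K ^ 2 := by nlinarith
  have h2 : |sqrtHermite k 2 u| ≤ 14 * a * K := by
    have hprod : |(u - (2 * k + 1)) * sqrtHermite k 0 u| ≤ 3 * (a * K) := by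
      rw [abs_mul]
      calc _ ≤ 3 * K ^ 2 * (a / K) := by gcongr
        _ = 3 * (a * K) := by field_simp
    have heq : sqrtHermite k 2 u =
        ((u - (2 * k + 1)) * sqrtHermite k 0 u - 2 * sqrtHermite k 1 u) / (4 * u) := by
      simp only [sqrtHermite]
    rw [heq]
    refine (hdiv _).trans ?_
    have := abs_sub ((u - (2 * k + 1)) * sqrtHermite k 0 u) (2 * sqrtHermite k 1 u)
    rw [abs_mul 2, abs_two] at this
    linarith
  refine ⟨h0, h1, h2, ?_⟩
  have hprod : |(u - (2 * k + 1)) * sqrtHermite k 1 u| ≤ 6 * (a * K ^ 2) := by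
    rw [abs_mul]
    calc _ ≤ 3 * K ^ 2 * (2 * a) := by gcongr
      _ = 6 * (a * K ^ 2) := by ring
  have h0' : |sqrtHermite k 0 u| ≤ a := h0.trans (div_le_self ha0 hK1)
  have heq : sqrtHermite k 3 u = (sqrtHermite k 0 u + (u - (2 * k + 1)) * sqrtHermite k 1 u
      - 6 * sqrtHermite k 2 u) / (4 * u) := by simp only [sqrtHermite]
  rw [heq]
  refine (hdiv _).trans ?_
  have e1 := abs_sub (sqrtHermite k 0 u + (u - (2 * k + 1)) * sqrtHermite k 1 u)
    (6 * sqrtHermite k 2 u)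
  have e2 := abs_add_le (sqrtHermite k 0 u) ((u - (2 * k + 1)) * sqrtHermite k 1 u)
  rw [abs_mul 6, abs_of_pos (show (0 : ℝ) < 6 by norm_num)] at e1
  linarith

theorem abs_iteratedDeriv_three_OmegaFun_le (k : ℕ) (hk : 1 ≤ k) {s : ℝ} (hs₀ : 0 ≤ s)
    (hs₁ : s ≤ 7 / 8) : |iteratedDeriv 3 (OmegaFun k) s| ≤ 1064 * k := by
  have hk' : (1 : ℝ) ≤ k := by exact_mod_cast hk
  obtain ⟨K, hK⟩ : ∃ K, K = Real.sqrt k := ⟨_, rfl⟩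
  obtain ⟨a, ha⟩ : ∃ a, a = Real.sqrt (2 * K) := ⟨_, rfl⟩
  have hK1 : 1 ≤ K := hK ▸ Real.one_le_sqrt.2 hk'
  have hKk : (k : ℝ) = K ^ 2 := by rw [hK, Real.sq_sqrt (by positivity)]
  have ha0 : 0 ≤ a := ha ▸ Real.sqrt_nonneg _
  have ha2 : a ^ 2 = 2 * K := by rw [ha, Real.sq_sqrt (by positivity)]
  obtain ⟨m0, m1, m2, m3⟩ :=
    abs_sqrtHermite_le k hk (u := 1 - s) (by linarith) (by linarith) hK ha
  obtain ⟨p0, p1, p2, p3⟩ :=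
    abs_sqrtHermite_le k hk (u := 1 + s) (by linarith) (by linarith) hK ha
  rw [(iteratedDeriv_OmegaFun k (s := s) ⟨by linarith, by linarith⟩).2]
  have mul_bound {x y b c : ℝ} (hx : |x| ≤ b) (hy : |y| ≤ c) : |x * y| ≤ b * c := by
    rw [abs_mul]
    exact mul_le_mul hx hy (abs_nonneg y) ((abs_nonneg x).trans hx)
  have q1 := abs_le.1 (mul_bound m3 p0)
  have q2 := abs_le.1 (mul_bound m2 p1)
  have q3 := abs_le.1 (mul_bound m1 p2)
  have q4 := abs_le.1 (mul_bound m0 p3)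
  have v1 : 182 * a * K ^ 2 * (a / K) = 364 * k := by
    rw [hKk]; field_simp; rw [ha2]; ring
  have v2 : 14 * a * K * (2 * a) = 56 * k := by
    rw [hKk]; linear_combination 28 * K * ha2
  rw [v1] at q1
  rw [v2] at q2
  rw [mul_comm, v2] at q3
  rw [mul_comm (a / K), v1] at q4
  rw [abs_le]
  constructor <;> linarith [q1.1, q1.2, q2.1, q2.2, q3.1, q3.2, q4.1, q4.2]

theorem statement12 :
    ∃ C₁ C₁' C₂ : ℝ, 0 < C₁ ∧ 0 < C₁' ∧ 0 < C₂ ∧ ∀ k : ℕ, 1 ≤ k →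
      (C₁ * Real.sqrt k ≤ iteratedDeriv 2 (OmegaFun k) 0 ∧
        iteratedDeriv 2 (OmegaFun k) 0 ≤ C₁' * Real.sqrt k) ∧
      ∀ s ∈ Set.Icc (0 : ℝ) (Real.sqrt 3 / 2),
        |iteratedDeriv 3 (OmegaFun k) s| ≤ C₂ * k := by
  refine ⟨1 / 16, 2, 1064, by norm_num, by norm_num, by norm_num, fun k hk => ⟨?_, ?_⟩⟩
  · have hk' : (1 : ℝ) ≤ k := by exact_mod_cast hk
    have hE : hermiteEnergy k 1 = hermiteFunDeriv k 1 ^ 2 + 2 * k * hermiteFun k 1 ^ 2 := by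
      unfold hermiteEnergy; ring
    have hkh : hermiteFun k 1 ^ 2 ≤ k * hermiteFun k 1 ^ 2 :=
      le_mul_of_one_le_left (sq_nonneg _) hk'
    have hup := (hermiteEnergy_le_zero k zero_le_one).trans (hermiteEnergy_zero_le k hk)
    have hlow := (sqrt_div_two_le_hermiteEnergy_zero k).trans
      (hermiteEnergy_zero_le_two_mul k hk)
    have hadd := sq_nonneg (hermiteFun k 1 + hermiteFunDeriv k 1)
    have hsub := sq_nonneg (hermiteFun k 1 - hermiteFunDeriv k 1)
    rw [iteratedDeriv_two_OmegaFun_zero]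
    constructor <;> nlinarith [sq_nonneg (hermiteFun k 1), sq_nonneg (hermiteFunDeriv k 1)]
  · intro s hs
    have h3 : Real.sqrt 3 ≤ 7 / 4 := Real.sqrt_le_iff.2 (by norm_num)
    exact abs_iteratedDeriv_three_OmegaFun_le k hk hs.1 (by linarith [hs.2])

end
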